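/- arXiv:2007.15567 — 4 statements merged into one kernel-verified Lean document; each statement's English description precedes it below -/
import Mathlib

section
/- Let S and T be probability measures on X × Y, let ℓ(x,y) = L(h(x,y)) be the composed loss of a hypothesis h and loss L, and let M = (1/2)(S+T). Suppose ℓ is (σ,a)-sub-Gamma under M, i.e. log E_M[exp(λ(ℓ − E_M[ℓ]))] ≤ λ²σ / (2(1 − a|λ|)) for all λ with 0 < |λ| < 1/a. Then R_T(h) ≤ R_S(h) + (σ+1)·√(2·D_JS(T‖S)) + 2a·D_JS(T‖S). -/
open MeasureTheory Real
open scoped ENNReal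

/-- Kullback–Leibler divergence (natural logarithm) of `Q` with respect to `P`:
`E_Q[log (dQ/dP)]`; meaningful when `Q ≪ P`. -/
noncomputable def KLdiv {Ω : Type*} [MeasurableSpace Ω] (Q P : Measure Ω) : ℝ :=
  ∫ ω, Real.log ((Q.rnDeriv P ω).toReal) ∂Q

/-- Jensen–Shannon divergence: with `M = (P + Q)/2`,
`D_JS(P‖Q) = (D_KL(P‖M) + D_KL(Q‖M))/2`. -/
noncomputable def JSdiv {Ω : Type*} [MeasurableSpace Ω] (P Q : Measure Ω) : ℝ :=
  (KLdiv P ((2 : ℝ≥0∞)⁻¹ • P + (2 : ℝ≥0∞)⁻¹ • Q) +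
    KLdiv Q ((2 : ℝ≥0∞)⁻¹ • P + (2 : ℝ≥0∞)⁻¹ • Q)) / 2

/-- Risk of hypothesis `h` under loss `L` with respect to distribution `D`. -/
noncomputable def risk {X Y : Type*} [MeasurableSpace X] [MeasurableSpace Y]
    (D : Measure (X × Y)) (h : X × Y → ℝ) (L : ℝ → ℝ) : ℝ :=
  ∫ p, L (h p) ∂D

open InformationTheory ProbabilityTheory

namespace MeasureTheory

variable {Ω : Type*} [MeasurableSpace Ω]

lemma integrable_llr_of_le_smul {μ ν : Measure Ω} [IsFiniteMeasure μ] [IsFiniteMeasure ν]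
    {c : ℝ≥0∞} (hc : c ≠ ∞) (hle : μ ≤ c • ν) : Integrable (llr μ ν) μ := by
  have hac : μ ≪ ν := Measure.absolutelyContinuous_of_le_smul hle
  have hbound : μ.rnDeriv ν ≤ᵐ[ν] fun _ ↦ c := by
    refine ae_le_of_forall_setLIntegral_le_of_sigmaFinite (μ.measurable_rnDeriv ν) fun s _ _ ↦ ?_
    rw [setLIntegral_const]
    exact (Measure.setLIntegral_rnDeriv_le s).trans (hle s)
  obtain ⟨B, hB⟩ := (isCompact_Icc (a := (0 : ℝ)) (b := c.toReal)).exists_bound_of_continuousOn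
    continuous_klFun.continuousOn
  rw [← integrable_klFun_rnDeriv_iff hac]
  refine Integrable.of_bound (C := B) ?_ ?_
  · exact (measurable_klFun.comp (μ.measurable_rnDeriv ν).ennreal_toReal).aestronglyMeasurable
  · filter_upwards [hbound] with x hx
    exact hB _ ⟨ENNReal.toReal_nonneg, ENNReal.toReal_mono hc hx⟩

lemma integral_llr_nonneg {μ ν : Measure Ω} [IsProbabilityMeasure μ] [IsProbabilityMeasure ν]
    (hac : μ ≪ ν) : 0 ≤ ∫ x, llr μ ν x ∂μ := by
  rw [← toReal_klDiv_of_measure_eq hac (by simp)]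
  exact ENNReal.toReal_nonneg

/-- The Donsker–Varadhan inequality. -/
lemma integral_le_integral_llr_add_log_integral_exp {μ ν : Measure Ω} [IsProbabilityMeasure μ]
    [IsProbabilityMeasure ν] (hac : μ ≪ ν) (hllr : Integrable (llr μ ν) μ) {f : Ω → ℝ}
    (hf : Integrable f μ) (hexp : Integrable (fun x ↦ exp (f x)) ν) :
    ∫ x, f x ∂μ ≤ ∫ x, llr μ ν x ∂μ + log (∫ x, exp (f x) ∂ν) := by
  have := isProbabilityMeasure_tilted hexp
  have h := integral_llr_nonneg (hac.trans (absolutelyContinuous_tilted hexp))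
  rw [integral_llr_tilted_right hac hf hexp hllr] at h
  linarith

lemma integrable_of_integrable_exp_mul_sub {ν : Measure Ω} [IsFiniteMeasure ν] {f : Ω → ℝ}
    {b c : ℝ} (hb : 0 < b)
    (hexp : ∀ l : ℝ, 0 < |l| → |l| < b → Integrable (fun x ↦ exp (l * (f x - c))) ν) :
    Integrable f ν := by
  have hmem : (0 : ℝ) ∈ interior (integrableExpSet (fun x ↦ f x - c) ν) := by
    refine mem_interior.2 ⟨Set.Ioo (-b) b, fun l hl ↦ ?_, isOpen_Ioo, by simpa using hb⟩
    by_cases h0 : l = 0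
    · simp [integrableExpSet, h0]
    · exact hexp l (abs_pos.2 h0) (abs_lt.2 hl)
  refine ((integrable_of_mem_interior_integrableExpSet hmem).add (integrable_const c)).congr
    (.of_forall fun x ↦ ?_)
  simp

end MeasureTheory

/-- Inversion of a sub-Gamma bound, using the choice `l = √(2 J) / (1 + a √(2 J))`. -/
lemma le_of_forall_mul_le_subGamma {σ a J δ : ℝ} (ha : 0 < a) (hJ : 0 ≤ J)
    (H : ∀ l : ℝ, 0 < l → l < 1 / a → l * δ ≤ 2 * J + l ^ 2 * σ / (1 - a * l)) :
    δ ≤ (σ + 1) * √(2 * J) + 2 * a * J := by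
  have key : ∀ u : ℝ, 0 < u → u * δ ≤ 2 * J * (1 + a * u) + u ^ 2 * σ := by
    intro u hu
    have hau : 0 < 1 + a * u := by positivity
    have h := H (u / (1 + a * u)) (by positivity) (by
      rw [div_lt_div_iff₀ hau ha]; linarith)
    have h1 : 1 - a * (u / (1 + a * u)) = 1 / (1 + a * u) := by field_simp; ring
    rw [h1] at h
    have h2 := mul_le_mul_of_nonneg_left h hau.le
    have h3 : (1 + a * u) * (u / (1 + a * u) * δ) = u * δ := by field_simp
    have h4 : (1 + a * u) * (2 * J + (u / (1 + a * u)) ^ 2 * σ / (1 / (1 + a * u)))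
        = 2 * J * (1 + a * u) + u ^ 2 * σ := by field_simp
    linarith
  rcases hJ.eq_or_lt with rfl | hJ
  · have hu : ∀ u : ℝ, 0 < u → δ ≤ u * σ := by
      intro u hu
      have h := key u hu
      refine le_of_mul_le_mul_left ?_ hu
      linarith
    have hlim : Filter.Tendsto (fun u : ℝ ↦ u * σ) (nhdsWithin 0 (Set.Ioi 0)) (nhds 0) := by
      have : Filter.Tendsto (fun u : ℝ ↦ u * σ) (nhds 0) (nhds (0 * σ)) :=
        (continuous_id.mul continuous_const).tendsto 0
      rw [zero_mul] at this
      exact this.mono_left nhdsWithin_le_nhds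
    simpa using ge_of_tendsto hlim (eventually_mem_nhdsWithin.mono hu)
  · have hs : 0 < √(2 * J) := by positivity
    have hsq : √(2 * J) ^ 2 = 2 * J := sq_sqrt (by positivity)
    refine le_of_mul_le_mul_left (a := √(2 * J)) ?_ hs
    have h := key _ hs
    linear_combination h - hsq

/-- if the composed loss `ℓ = L ∘ h` is `(σ, a)`-sub-Gamma under the mixture
`M = (S+T)/2`, then `R_T(h) ≤ R_S(h) + (σ+1) √(2 D_JS(T‖S)) + 2a D_JS(T‖S)`. -/
theorem target_risk_upper_bound_subGamma {X Y : Type*} [MeasurableSpace X] [MeasurableSpace Y]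
    (S T : Measure (X × Y)) [IsProbabilityMeasure S] [IsProbabilityMeasure T]
    (h : X × Y → ℝ) (L : ℝ → ℝ) (σ a : ℝ) (ha : 0 < a)
    (M : Measure (X × Y)) (hM : M = (2 : ℝ≥0∞)⁻¹ • S + (2 : ℝ≥0∞)⁻¹ • T)
    (hint : ∀ l : ℝ, 0 < |l| → |l| < 1 / a →
      Integrable (fun p => Real.exp (l * (L (h p) - ∫ q, L (h q) ∂M))) M)
    (hsubGamma : ∀ l : ℝ, 0 < |l| → |l| < 1 / a →
      Real.log (∫ p, Real.exp (l * (L (h p) - ∫ q, L (h q) ∂M)) ∂M) ≤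
        l ^ 2 * σ / (2 * (1 - a * |l|))) :
    risk T h L ≤ risk S h L + (σ + 1) * Real.sqrt (2 * JSdiv T S) + 2 * a * JSdiv T S := by
  have hleT : T ≤ (2 : ℝ≥0∞) • M := by
    rw [hM, smul_add, smul_smul, smul_smul, ENNReal.mul_inv_cancel (by simp) (by simp), one_smul,
      one_smul]
    exact Measure.le_add_left le_rfl
  have hleS : S ≤ (2 : ℝ≥0∞) • M := by
    rw [hM, smul_add, smul_smul, smul_smul, ENNReal.mul_inv_cancel (by simp) (by simp), one_smul,
      one_smul]
    exact Measure.le_add_right le_rfl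
  have hprob : IsProbabilityMeasure M := ⟨by simp [hM, ENNReal.inv_two_add_inv_two]⟩
  have hacT : T ≪ M := Measure.absolutelyContinuous_of_le_smul hleT
  have hacS : S ≪ M := Measure.absolutelyContinuous_of_le_smul hleS
  have hllrT := integrable_llr_of_le_smul (by simp) hleT
  have hllrS := integrable_llr_of_le_smul (by simp) hleS
  have hfM : Integrable (fun p ↦ L (h p)) M :=
    integrable_of_integrable_exp_mul_sub (one_div_pos.2 ha) hint
  have hfT : Integrable (fun p ↦ L (h p)) T := hfM.of_measure_le_smul (by simp) hleT
  have hfS : Integrable (fun p ↦ L (h p)) S := hfM.of_measure_le_smul (by simp) hleS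
  have hJS : 2 * JSdiv T S = ∫ p, llr T M p ∂T + ∫ p, llr S M p ∂S := by
    simp only [JSdiv, KLdiv, llr, hM, add_comm ((2 : ℝ≥0∞)⁻¹ • T)]
    ring
  have hJ : 0 ≤ JSdiv T S := by
    linarith [integral_llr_nonneg hacT, integral_llr_nonneg hacS]
  have hDV : ∀ (D : Measure (X × Y)) [IsProbabilityMeasure D], D ≪ M → Integrable (llr D M) D →
      Integrable (fun p ↦ L (h p)) D → ∀ l : ℝ, 0 < |l| → |l| < 1 / a →
      l * (risk D h L - ∫ q, L (h q) ∂M) ≤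
        ∫ p, llr D M p ∂D + l ^ 2 * σ / (2 * (1 - a * |l|)) := by
    intro D _ hac hllr hf l hl0 hl
    have hbound := integral_le_integral_llr_add_log_integral_exp hac hllr
      ((hf.sub (integrable_const (∫ q, L (h q) ∂M))).const_mul l) (hint l hl0 hl)
    have hmean : ∫ p, l * (L (h p) - ∫ q, L (h q) ∂M) ∂D
        = l * (risk D h L - ∫ q, L (h q) ∂M) := by
      rw [integral_const_mul, integral_sub hf (integrable_const _)]
      simp [risk]
    simp only [Pi.sub_apply] at hbound
    rw [hmean] at hbound
    linarith [hsubGamma l hl0 hl]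
  have hmain := le_of_forall_mul_le_subGamma (σ := σ) (δ := risk T h L - risk S h L) ha hJ (by
    intro l hl0 hl
    have h1 := hDV T hacT hllrT hfT l (by rwa [abs_of_pos hl0]) (by rwa [abs_of_pos hl0])
    have h2 := hDV S hacS hllrS hfS (-l) (by rwa [abs_neg, abs_of_pos hl0])
      (by rwa [abs_neg, abs_of_pos hl0])
    rw [abs_neg, neg_sq] at h2
    rw [abs_of_pos hl0] at h1 h2
    have hhalf : l ^ 2 * σ / (1 - a * l) = 2 * (l ^ 2 * σ / (2 * (1 - a * l))) := by
      rw [mul_div_assoc', mul_div_mul_left _ _ two_ne_zero]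
    rw [hhalf, hJS]
    linarith)
  linarith
end

section
/- Let Y₁ and Y₂ be finite sets with |Y₁| = |Y₂| = N and |Y₁ ∩ Y₂| = αN for some α ∈ [0,1], and let S(y) = Unif(Y₁) and T(y) = Unif(Y₂) be the uniform distributions on Y₁ and Y₂ respectively. Then D_JS(T(y)‖S(y)) = (1 − α)·log 2. -/
open MeasureTheory Real
open scoped ENNReal

/-- At an atom of `Q`, the Radon–Nikodym derivative is the ratio of the masses. -/
theorem rnDeriv_eq_div_singleton {Ω : Type*} [MeasurableSpace Ω] [MeasurableSingletonClass Ω]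
    {P Q : Measure Ω} [SigmaFinite P] [IsFiniteMeasure Q] (h : P ≪ Q) {a : Ω} (ha : Q {a} ≠ 0) :
    P.rnDeriv Q a = P {a} / Q {a} := by
  have key := Measure.setLIntegral_rnDeriv h {a}
  rw [lintegral_singleton] at key
  rw [ENNReal.eq_div_iff ha (measure_ne_top Q _), mul_comm, key]

/-- The mass of a singleton under a uniform distribution. -/
theorem toMeasure_uniformOfFinset_singleton {Y : Type*} [MeasurableSpace Y]
    [MeasurableSingletonClass Y] [DecidableEq Y] (s : Finset Y) (hs : s.Nonempty) (a : Y) :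
    (PMF.uniformOfFinset s hs).toMeasure {a} = if a ∈ s then (s.card : ℝ≥0∞)⁻¹ else 0 := by
  rw [PMF.toMeasure_apply_singleton _ _ (measurableSet_singleton a)]
  simp [PMF.uniformOfFinset_apply]

/-- Expectation under a uniform distribution is the average. -/
theorem integral_uniformOfFinset {Y : Type*} [MeasurableSpace Y]
    [MeasurableSingletonClass Y] [DecidableEq Y] (s : Finset Y) (hs : s.Nonempty) (f : Y → ℝ) :
    ∫ y, f y ∂(PMF.uniformOfFinset s hs).toMeasure = (s.card : ℝ)⁻¹ * ∑ y ∈ s, f y := by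
  have hmem : ∀ᵐ y ∂(PMF.uniformOfFinset s hs).toMeasure, y ∈ (s : Set Y) := by
    rw [ae_iff]
    change (PMF.uniformOfFinset s hs).toMeasure (s : Set Y)ᶜ = 0
    rw [PMF.toMeasure_apply_eq_zero_iff _ s.measurableSet.compl]
    simpa using disjoint_compl_right
  rw [← Measure.restrict_eq_self_of_ae_mem hmem,
    setIntegral_finset s IntegrableOn.finset, Finset.mul_sum]
  refine Finset.sum_congr rfl fun y hy ↦ ?_
  rw [measureReal_def, toMeasure_uniformOfFinset_singleton, if_pos hy]
  simp

/-- Divergence of a uniform distribution from its midpoint with another one of equal support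
size. -/
theorem KLdiv_uniformOfFinset_midpoint {Y : Type*} [MeasurableSpace Y]
    [MeasurableSingletonClass Y] [DecidableEq Y] (s t : Finset Y) (hs : s.Nonempty)
    (ht : t.Nonempty) (hst : s.card = t.card) :
    KLdiv (PMF.uniformOfFinset s hs).toMeasure
      ((2 : ℝ≥0∞)⁻¹ • (PMF.uniformOfFinset s hs).toMeasure +
        (2 : ℝ≥0∞)⁻¹ • (PMF.uniformOfFinset t ht).toMeasure) =
      (1 - ((s ∩ t).card : ℝ) / s.card) * Real.log 2 := by
  set P := (PMF.uniformOfFinset s hs).toMeasure with hP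
  set Q := (PMF.uniformOfFinset t ht).toMeasure with hQ
  have hcard : (s.card : ℝ) ≠ 0 := by exact_mod_cast hs.card_pos.ne'
  have hac : P ≪ (2 : ℝ≥0∞)⁻¹ • P + (2 : ℝ≥0∞)⁻¹ • Q :=
    (Measure.absolutelyContinuous_smul (by simp)).add_right _
  have : IsFiniteMeasure ((2 : ℝ≥0∞)⁻¹ • P) := P.smul_finite (by simp)
  have : IsFiniteMeasure ((2 : ℝ≥0∞)⁻¹ • Q) := Q.smul_finite (by simp)
  have hlog : ∀ y ∈ s, Real.log
      ((P.rnDeriv ((2 : ℝ≥0∞)⁻¹ • P + (2 : ℝ≥0∞)⁻¹ • Q) y).toReal) =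
      if y ∈ t then 0 else Real.log 2 := by
    intro y hy
    have hM : ((2 : ℝ≥0∞)⁻¹ • P + (2 : ℝ≥0∞)⁻¹ • Q) {y} ≠ 0 := by
      simp [hP, hy]
    rw [rnDeriv_eq_div_singleton hac hM]
    by_cases hyt : y ∈ t
    · simp only [Measure.add_apply, Measure.smul_apply, smul_eq_mul, hP, hQ,
        toMeasure_uniformOfFinset_singleton, hy, hyt, if_true, ← hst]
      rw [← add_mul, ENNReal.inv_two_add_inv_two, one_mul, ENNReal.div_self] <;>
        simp [hs.ne_empty]
    · simp only [Measure.add_apply, Measure.smul_apply, smul_eq_mul, hP, hQ,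
        toMeasure_uniformOfFinset_singleton, hy, hyt, if_true, if_false, mul_zero, add_zero]
      congr 1
      simp only [ENNReal.toReal_div, ENNReal.toReal_mul, ENNReal.toReal_inv,
        ENNReal.toReal_natCast, ENNReal.toReal_ofNat]
      field_simp
  have hsplit : ((s ∩ t).card : ℝ) + (s \ t).card = s.card := by
    exact_mod_cast Finset.card_inter_add_card_sdiff s t
  rw [KLdiv, integral_uniformOfFinset, Finset.sum_congr rfl hlog, Finset.sum_ite,
    Finset.sum_const_zero, zero_add, Finset.sum_const, nsmul_eq_mul,
    Finset.filter_notMem_eq_sdiff, eq_sub_of_add_eq' hsplit]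
  field_simp

/-- for uniform distributions on two finite label sets of equal size `N`
sharing `αN` classes, the Jensen–Shannon divergence equals `(1 - α) log 2`. -/
theorem jsDiv_uniform_overlap {Y : Type*} [MeasurableSpace Y] [MeasurableSingletonClass Y]
    [DecidableEq Y] (Y₁ Y₂ : Finset Y) (h₁ : Y₁.Nonempty) (h₂ : Y₂.Nonempty)
    (N : ℕ) (hN : 0 < N) (hc₁ : Y₁.card = N) (hc₂ : Y₂.card = N)
    (α : ℝ) (hα₀ : 0 ≤ α) (hα₁ : α ≤ 1)
    (hcap : ((Y₁ ∩ Y₂).card : ℝ) = α * N) :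
    JSdiv ((PMF.uniformOfFinset Y₂ h₂).toMeasure) ((PMF.uniformOfFinset Y₁ h₁).toMeasure) =
      (1 - α) * Real.log 2 := by
  have hN' : (N : ℝ) ≠ 0 := by exact_mod_cast hN.ne'
  have hdiv : ((Y₁ ∩ Y₂).card : ℝ) / N = α := by rw [hcap, mul_div_cancel_right₀ _ hN']
  rw [JSdiv, KLdiv_uniformOfFinset_midpoint Y₂ Y₁ h₂ h₁ (hc₂.trans hc₁.symm),
    add_comm ((2 : ℝ≥0∞)⁻¹ • (PMF.uniformOfFinset Y₂ h₂).toMeasure),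
    KLdiv_uniformOfFinset_midpoint Y₁ Y₂ h₁ h₂ (hc₁.trans hc₂.symm),
    Finset.inter_comm Y₂ Y₁, hc₁, hc₂, hdiv]
  ring
end

section
/- Let Ŝ(z) and T̂(z) be probability distributions over a countable feature space Z, let h(y|z) be a (shared) stochastic classifier kernel from Z to a finite label set Y, and define the prediction output (pseudo-label) distributions Ŝ_p(y) = Σ_z h(y|z)·Ŝ(z) and T̂_p(y) = Σ_z h(y|z)·T̂(z). Suppose the pseudo-label prediction error on the target is D_JS(T̂(y)‖T̂_p(y)) = P, the source prediction error satisfies D_JS(Ŝ(y)‖Ŝ_p(y)) ≤ ε₁, and the ground-truth label marginal divergence satisfies D_JS(Ŝ(y)‖T̂(y)) ≤ ε₂, where Ŝ(y), T̂(y) are the ground-truth label marginals. Then the feature marginal divergence is lower bounded: D_JS(Ŝ(z)‖T̂(z)) ≥ (max(√P − √ε₁ − √ε₂, 0))². -/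
open MeasureTheory Real
open scoped ENNReal

open ProbabilityTheory


/-- The pointwise Jensen–Shannon integrand, for densities `a` and `b`. -/
noncomputable def jsFun (a b : ℝ) : ℝ :=
  (a * log a + b * log b - (a + b) * log ((a + b) / 2)) / 2

lemma jsFun_comm (a b : ℝ) : jsFun a b = jsFun b a := by
  unfold jsFun
  rw [add_comm a b]
  ring

lemma continuous_jsFun : Continuous fun x : ℝ × ℝ ↦ jsFun x.1 x.2 := by
  have h : (fun x : ℝ × ℝ ↦ jsFun x.1 x.2) = fun x : ℝ × ℝ ↦
      (x.1 * log x.1 + x.2 * log x.2 - 2 * ((x.1 + x.2) / 2 * log ((x.1 + x.2) / 2))) / 2 := by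
    ext x
    unfold jsFun
    ring
  rw [h]
  have hc := Real.continuous_mul_log
  have h1 := hc.comp (continuous_fst (X := ℝ) (Y := ℝ))
  have h2 := hc.comp (continuous_snd (X := ℝ) (Y := ℝ))
  have h3 := hc.comp ((continuous_fst.add continuous_snd).div_const (2 : ℝ))
  exact ((h1.add h2).sub (h3.const_mul 2)).div_const 2

/-- Minkowski's inequality in `L²`, in terms of Bochner integrals. -/
lemma sqrt_integral_add_sq_le {α : Type*} [MeasurableSpace α] {μ : Measure α} {f g : α → ℝ}
    (hf : MemLp f 2 μ) (hg : MemLp g 2 μ) :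
    √(∫ x, (f x + g x) ^ 2 ∂μ) ≤ √(∫ x, f x ^ 2 ∂μ) + √(∫ x, g x ^ 2 ∂μ) := by
  have key : ∀ {h : α → ℝ}, MemLp h 2 μ → √(∫ x, h x ^ 2 ∂μ) = (eLpNorm h 2 μ).toReal := by
    intro h hh
    rw [hh.eLpNorm_eq_integral_rpow_norm (by norm_num) (by norm_num),
      ENNReal.toReal_ofReal (by positivity), Real.sqrt_eq_rpow]
    simp
  rw [key hf, key hg, ← ENNReal.toReal_add hf.2.ne hg.2.ne]
  have := key (hf.add hg)
  simp only [Pi.add_apply] at this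
  rw [this]
  exact ENNReal.toReal_mono (ENNReal.add_ne_top.2 ⟨hf.2.ne, hg.2.ne⟩)
    (eLpNorm_add_le hf.1 hg.1 (by norm_num))

lemma exp_neg_sub_exp_neg_nonneg {a b t : ℝ} (hab : a ≤ b) (ht : 0 ≤ t) :
    0 ≤ exp (-(a * t)) - exp (-(b * t)) := by
  have := mul_le_mul_of_nonneg_right hab ht
  exact sub_nonneg.2 (exp_le_exp.2 (by linarith))

lemma exp_neg_sub_exp_neg_le (a b t : ℝ) :
    exp (-(a * t)) - exp (-(b * t)) ≤ (b - a) * t * exp (-(a * t)) := by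
  have h1 : exp (-(b * t)) = exp (-(a * t)) * exp (-((b - a) * t)) := by
    rw [← exp_add]; ring_nf
  have h2 := add_one_le_exp (-((b - a) * t))
  have h3 := mul_le_mul_of_nonneg_left h2 (exp_pos (-(a * t))).le
  rw [h1]
  linarith

lemma integrableOn_exp_neg_mul {a : ℝ} (ha : 0 < a) :
    IntegrableOn (fun t ↦ exp (-(a * t))) (Set.Ioi 0) := by
  simpa using integrableOn_exp_mul_Ioi (neg_lt_zero.2 ha) 0

lemma integrableOn_inv_mul_exp_sub {a b : ℝ} (ha : 0 < a) (hb : 0 < b) :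
    IntegrableOn (fun t ↦ t⁻¹ * (exp (-(a * t)) - exp (-(b * t)))) (Set.Ioi 0) := by
  wlog hab : a ≤ b generalizing a b
  · refine (this hb ha (le_of_not_ge hab)).neg.congr_fun (fun t _ ↦ ?_) measurableSet_Ioi
    simp only [Pi.neg_apply]
    ring
  refine ((integrableOn_exp_neg_mul ha).const_mul (b - a)).mono'
    (Measurable.aestronglyMeasurable (by fun_prop)) ?_
  filter_upwards [ae_restrict_mem measurableSet_Ioi] with t ht
  have ht : 0 < t := ht
  have h0 := exp_neg_sub_exp_neg_nonneg hab ht.le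
  rw [norm_of_nonneg (by positivity), inv_mul_le_iff₀ ht]
  linarith [exp_neg_sub_exp_neg_le a b t]

lemma integral_inv_mul_exp_sub {a b : ℝ} (ha : 0 < a) (hb : 0 < b) :
    ∫ t in Set.Ioi (0 : ℝ), t⁻¹ * (exp (-(a * t)) - exp (-(b * t))) = log (b / a) := by
  have hc : Continuous fun x : ℝ ↦ exp (-x) := by fun_prop
  have := Frullani.integral_Ioi_eq (f := fun x ↦ exp (-x)) (L := 1) (R := 0)
    (hc.locallyIntegrable.locallyIntegrableOn _) ha hb
    ((by simpa using hc.tendsto 0 : Filter.Tendsto _ _ _).mono_left nhdsWithin_le_nhds)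
    (tendsto_exp_neg_atTop_nhds_zero) (integrableOn_inv_mul_exp_sub ha hb)
  simpa using this

lemma integrableOn_exp_sub_div_sq {a b : ℝ} (ha : 0 < a) (hb : 0 < b) :
    IntegrableOn (fun t ↦ ((exp (-(a * t)) - exp (-(b * t))) / t) ^ 2) (Set.Ioi 0) := by
  wlog hab : a ≤ b generalizing a b
  · refine (this hb ha (le_of_not_ge hab)).congr_fun (fun t _ ↦ ?_) measurableSet_Ioi
    ring
  refine ((integrableOn_exp_neg_mul (a := 2 * a) (by positivity)).const_mul ((b - a) ^ 2)).mono'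
    (Measurable.aestronglyMeasurable (by fun_prop)) ?_
  filter_upwards [ae_restrict_mem measurableSet_Ioi] with t ht
  have ht : 0 < t := ht
  have h0 := exp_neg_sub_exp_neg_nonneg hab ht.le
  rw [norm_of_nonneg (by positivity)]
  have h1 : (b - a) ^ 2 * exp (-(2 * a * t)) = ((b - a) * exp (-(a * t))) ^ 2 := by
    rw [mul_pow, ← exp_nat_mul]
    push_cast
    ring_nf
  rw [h1]
  gcongr
  rw [div_le_iff₀ ht]
  linarith [exp_neg_sub_exp_neg_le a b t]

lemma memLp_exp_sub_div {a b : ℝ} (ha : 0 < a) (hb : 0 < b) :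
    MemLp (fun t ↦ (exp (-(a * t)) - exp (-(b * t))) / t) 2 (volume.restrict (Set.Ioi 0)) :=
  (memLp_two_iff_integrable_sq (Measurable.aestronglyMeasurable (by fun_prop))).2
    (integrableOn_exp_sub_div_sq ha hb)

/-- `jsFun` is a squared `L²` distance between functions of its two arguments. -/
lemma integral_exp_sub_div_sq {a b : ℝ} (ha : 0 < a) (hb : 0 < b) :
    ∫ t in Set.Ioi (0 : ℝ), ((exp (-(a * t)) - exp (-(b * t))) / t) ^ 2 = 4 * jsFun a b := by
  wlog hab : a ≤ b generalizing a b
  · rw [jsFun_comm, ← this hb ha (le_of_not_ge hab)]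
    congr with t
    ring
  set u : ℝ → ℝ := fun t ↦ exp (-(a * t)) - exp (-(b * t)) with hu
  set A : ℝ → ℝ := fun t ↦ t⁻¹ * (exp (-((2 * a) * t)) - exp (-((a + b) * t))) with hA
  set B : ℝ → ℝ := fun t ↦ t⁻¹ * (exp (-((a + b) * t)) - exp (-((2 * b) * t))) with hB
  have iA : IntegrableOn A (Set.Ioi 0) :=
    integrableOn_inv_mul_exp_sub (by positivity) (by positivity)
  have iB : IntegrableOn B (Set.Ioi 0) :=
    integrableOn_inv_mul_exp_sub (by positivity) (by positivity)
  have iU := integrableOn_exp_sub_div_sq ha hb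
  have iAB : IntegrableOn (fun t ↦ 2 * (b * B t - a * A t)) (Set.Ioi 0) :=
    ((iB.const_mul b).sub (iA.const_mul a)).const_mul 2
  have hbound : ∀ t, 0 ≤ t → ‖u t ^ 2 / t‖ ≤ (b - a) ^ 2 * t * exp (-(a * t)) ^ 2 := by
    intro t ht
    have h0 : 0 ≤ u t := exp_neg_sub_exp_neg_nonneg hab ht
    rw [norm_of_nonneg (by positivity)]
    rcases ht.eq_or_lt with rfl | ht
    · simp
    rw [div_le_iff₀ ht]
    calc u t ^ 2 ≤ ((b - a) * t * exp (-(a * t))) ^ 2 :=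
          pow_le_pow_left₀ h0 (exp_neg_sub_exp_neg_le a b t) 2
      _ = _ := by ring
  have hcont : ContinuousWithinAt (fun t ↦ u t ^ 2 / t) (Set.Ici 0) 0 := by
    have hlim : Filter.Tendsto (fun t ↦ (b - a) ^ 2 * t * exp (-(a * t)) ^ 2)
        (nhdsWithin 0 (Set.Ici 0)) (nhds 0) := by
      have : Continuous fun t ↦ (b - a) ^ 2 * t * exp (-(a * t)) ^ 2 := by fun_prop
      simpa using (this.tendsto 0).mono_left nhdsWithin_le_nhds
    unfold ContinuousWithinAt
    simp only [div_zero]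
    exact squeeze_zero_norm' (eventually_nhdsWithin_of_forall hbound) hlim
  have htop : Filter.Tendsto (fun t ↦ u t ^ 2 / t) Filter.atTop (nhds 0) := by
    have h1 : ∀ c : ℝ, 0 < c → Filter.Tendsto (fun t ↦ exp (-(c * t))) Filter.atTop (nhds 0) :=
      fun c hc ↦ tendsto_exp_neg_atTop_nhds_zero.comp (Filter.tendsto_id.const_mul_atTop hc)
    have h2 := (((h1 a ha).sub (h1 b hb)).pow 2).mul tendsto_inv_atTop_zero
    simpa [hu, div_eq_mul_inv] using h2
  have hderiv : ∀ t ∈ Set.Ioi (0 : ℝ), HasDerivAt (fun t ↦ u t ^ 2 / t)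
      (2 * (b * B t - a * A t) - (u t / t) ^ 2) t := by
    intro t ht
    have ht : t ≠ 0 := ne_of_gt ht
    have he : ∀ c : ℝ, HasDerivAt (fun t ↦ exp (-(c * t))) (exp (-(c * t)) * (-c)) t := fun c ↦ by
      simpa using ((hasDerivAt_id t).const_mul c).neg.exp
    refine ((((he a).sub (he b)).pow 2).div (hasDerivAt_id t) ht).congr_deriv ?_
    have e1 : exp (-((2 * a) * t)) = exp (-(a * t)) ^ 2 := by
      rw [← exp_nat_mul]; push_cast; ring_nf
    have e2 : exp (-((2 * b) * t)) = exp (-(b * t)) ^ 2 := by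
      rw [← exp_nat_mul]; push_cast; ring_nf
    have e3 : exp (-((a + b) * t)) = exp (-(a * t)) * exp (-(b * t)) := by
      rw [← exp_add]; ring_nf
    simp only [hA, hB, hu, e1, e2, e3, Pi.sub_apply, Pi.pow_apply, id]
    field_simp
    push_cast
    ring
  have hmain := integral_Ioi_of_hasDerivAt_of_tendsto hcont hderiv (iAB.sub iU) htop
  rw [integral_sub iAB iU, integral_const_mul,
    integral_sub (iB.const_mul b) (iA.const_mul a), integral_const_mul, integral_const_mul,
    integral_inv_mul_exp_sub (by positivity) (by positivity),
    integral_inv_mul_exp_sub (by positivity) (by positivity)] at hmain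
  have hs : 0 < a + b := by positivity
  simp only [div_zero, sub_zero] at hmain
  rw [← sub_eq_zero.1 hmain]
  unfold jsFun
  rw [log_div (by positivity) (by positivity), log_div (by positivity) (by positivity),
    log_div (by positivity) (by positivity), log_mul (by positivity) (by positivity),
    log_mul (by positivity) (by positivity)]
  ring

lemma jsFun_nonneg_of_pos {a b : ℝ} (ha : 0 < a) (hb : 0 < b) : 0 ≤ jsFun a b := by
  have := integral_exp_sub_div_sq ha hb
  have h : 0 ≤ ∫ t in Set.Ioi (0 : ℝ), ((exp (-(a * t)) - exp (-(b * t))) / t) ^ 2 :=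
    integral_nonneg fun t ↦ sq_nonneg _
  linarith

lemma sqrt_jsFun_triangle_of_pos {a b c : ℝ} (ha : 0 < a) (hb : 0 < b) (hc : 0 < c) :
    √(jsFun a c) ≤ √(jsFun a b) + √(jsFun b c) := by
  have h := sqrt_integral_add_sq_le (memLp_exp_sub_div ha hb) (memLp_exp_sub_div hb hc)
  have hac : ∀ t : ℝ, (exp (-(a * t)) - exp (-(b * t))) / t + (exp (-(b * t)) - exp (-(c * t))) / t
      = (exp (-(a * t)) - exp (-(c * t))) / t := fun t ↦ by ring
  simp_rw [hac] at h
  rw [integral_exp_sub_div_sq ha hc, integral_exp_sub_div_sq ha hb,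
    integral_exp_sub_div_sq hb hc] at h
  simp only [sqrt_mul (show (0 : ℝ) ≤ 4 by norm_num)] at h
  rw [← mul_add] at h
  exact le_of_mul_le_mul_left h (by positivity)

lemma tendsto_jsFun_add (a b : ℝ) :
    Filter.Tendsto (fun e ↦ jsFun (a + e) (b + e)) (nhdsWithin 0 (Set.Ioi 0))
      (nhds (jsFun a b)) := by
  have h : Continuous fun e : ℝ ↦ jsFun (a + e) (b + e) :=
    continuous_jsFun.comp (f := fun e : ℝ ↦ (a + e, b + e)) (by fun_prop)
  simpa using (h.tendsto 0).mono_left nhdsWithin_le_nhds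

lemma jsFun_nonneg {a b : ℝ} (ha : 0 ≤ a) (hb : 0 ≤ b) : 0 ≤ jsFun a b :=
  ge_of_tendsto (tendsto_jsFun_add a b) <| eventually_nhdsWithin_of_forall fun _ he ↦
    jsFun_nonneg_of_pos (add_pos_of_nonneg_of_pos ha he) (add_pos_of_nonneg_of_pos hb he)

/-- The square root of `jsFun` satisfies the triangle inequality. -/
lemma sqrt_jsFun_triangle {a b c : ℝ} (ha : 0 ≤ a) (hb : 0 ≤ b) (hc : 0 ≤ c) :
    √(jsFun a c) ≤ √(jsFun a b) + √(jsFun b c) :=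
  le_of_tendsto_of_tendsto (tendsto_jsFun_add a c).sqrt
    ((tendsto_jsFun_add a b).sqrt.add (tendsto_jsFun_add b c).sqrt) <|
    eventually_nhdsWithin_of_forall fun _ he ↦
      sqrt_jsFun_triangle_of_pos (add_pos_of_nonneg_of_pos ha he)
        (add_pos_of_nonneg_of_pos hb he) (add_pos_of_nonneg_of_pos hc he)

section Measure

variable {Ω : Type*} [MeasurableSpace Ω]

lemma abs_mul_log_div_half_add_le {a b : ℝ} (ha : 0 ≤ a) (hb : 0 ≤ b) :
    |a * log (a / ((a + b) / 2))| ≤ a + b := by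
  rcases ha.eq_or_lt with rfl | ha
  · simpa using hb
  have hm : 0 < (a + b) / 2 := by positivity
  have h1 := log_le_sub_one_of_pos (div_pos ha hm)
  have h2 := one_sub_inv_le_log_of_pos (div_pos ha hm)
  have h3 : a / ((a + b) / 2) ≤ 2 := by
    rw [div_le_iff₀ hm]
    linarith
  have h4 : a * (a / ((a + b) / 2))⁻¹ = (a + b) / 2 := by
    field_simp
  rw [abs_le]
  constructor
  · nlinarith [mul_le_mul_of_nonneg_left h2 ha.le]
  · nlinarith [mul_le_mul_of_nonneg_left h1 ha.le, mul_le_mul_of_nonneg_left h3 ha.le]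

lemma mul_log_div_half_add {a b : ℝ} (ha : 0 ≤ a) (hb : 0 ≤ b) :
    a * log (a / ((a + b) / 2)) = a * log a - a * log ((a + b) / 2) := by
  rcases ha.eq_or_lt with rfl | ha
  · simp
  rw [log_div ha.ne' (by positivity)]
  ring

lemma half_smul_add_half_smul_comm (P Q : Measure Ω) :
    (2 : ℝ≥0∞)⁻¹ • P + (2 : ℝ≥0∞)⁻¹ • Q = (2 : ℝ≥0∞)⁻¹ • Q + (2 : ℝ≥0∞)⁻¹ • P :=
  add_comm _ _

instance isProbabilityMeasure_half_smul_add_half_smul (P Q : Measure Ω) [IsProbabilityMeasure P]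
    [IsProbabilityMeasure Q] :
    IsProbabilityMeasure ((2 : ℝ≥0∞)⁻¹ • P + (2 : ℝ≥0∞)⁻¹ • Q) :=
  ⟨by simp [ENNReal.inv_two_add_inv_two]⟩

lemma absolutelyContinuous_half_smul_add (P Q : Measure Ω) :
    P ≪ (2 : ℝ≥0∞)⁻¹ • P + (2 : ℝ≥0∞)⁻¹ • Q :=
  (Measure.absolutelyContinuous_smul (by simp)).add_right _

lemma JSdiv_comm (P Q : Measure Ω) : JSdiv P Q = JSdiv Q P := by
  unfold JSdiv
  rw [half_smul_add_half_smul_comm P Q, add_comm]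

lemma llr_half_smul_add_ae_eq {P Q μ : Measure Ω} [IsProbabilityMeasure P] [IsProbabilityMeasure Q]
    [IsFiniteMeasure μ] (hP : P ≪ μ) (hQ : Q ≪ μ) :
    llr P ((2 : ℝ≥0∞)⁻¹ • P + (2 : ℝ≥0∞)⁻¹ • Q) =ᵐ[P] fun x ↦
      log ((P.rnDeriv μ x).toReal /
        (((P.rnDeriv μ x).toReal + (Q.rnDeriv μ x).toReal) / 2)) := by
  set M := (2 : ℝ≥0∞)⁻¹ • P + (2 : ℝ≥0∞)⁻¹ • Q with hM
  have := Measure.smul_finite P (c := (2 : ℝ≥0∞)⁻¹) (by simp)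
  have := Measure.smul_finite Q (c := (2 : ℝ≥0∞)⁻¹) (by simp)
  have hMμ : M ≪ μ := (hP.smul_left _).add_left (hQ.smul_left _)
  have h1 := (absolutelyContinuous_half_smul_add P Q) (Measure.rnDeriv_eq_div hP hMμ)
  have h2 := hP (Measure.rnDeriv_add' ((2 : ℝ≥0∞)⁻¹ • P) ((2 : ℝ≥0∞)⁻¹ • Q) μ)
  have h3 := hP (Measure.rnDeriv_smul_left_of_ne_top P μ (r := (2 : ℝ≥0∞)⁻¹) (by simp))
  have h4 := hP (Measure.rnDeriv_smul_left_of_ne_top Q μ (r := (2 : ℝ≥0∞)⁻¹) (by simp))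
  filter_upwards [h1, h2, h3, h4, hP (P.rnDeriv_lt_top μ), hP (Q.rnDeriv_lt_top μ)]
    with x h1 h2 h3 h4 h5 h6
  have h7 : M.rnDeriv μ x = 2⁻¹ * P.rnDeriv μ x + 2⁻¹ * Q.rnDeriv μ x := by
    rw [hM, h2, Pi.add_apply, h3, h4]
    simp
  rw [llr, h1, h7, ENNReal.toReal_div, ENNReal.toReal_add
    (ENNReal.mul_ne_top (by simp) h5.ne) (ENNReal.mul_ne_top (by simp) h6.ne)]
  simp only [ENNReal.toReal_mul, ENNReal.toReal_inv, ENNReal.toReal_ofNat]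
  ring_nf

lemma integrable_mul_log_rnDeriv (P Q μ : Measure Ω) [IsFiniteMeasure P] [IsFiniteMeasure Q] :
    Integrable (fun x ↦ (P.rnDeriv μ x).toReal * log ((P.rnDeriv μ x).toReal /
        (((P.rnDeriv μ x).toReal + (Q.rnDeriv μ x).toReal) / 2))) μ := by
  refine (Measure.integrable_toReal_rnDeriv (μ := P) (ν := μ) |>.add
    (Measure.integrable_toReal_rnDeriv (μ := Q) (ν := μ))).mono'
    (Measurable.aestronglyMeasurable (by fun_prop)) (Filter.Eventually.of_forall fun x ↦ ?_)
  exact abs_mul_log_div_half_add_le ENNReal.toReal_nonneg ENNReal.toReal_nonneg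

lemma KLdiv_half_smul_add {P Q μ : Measure Ω} [IsProbabilityMeasure P] [IsProbabilityMeasure Q]
    [IsFiniteMeasure μ] (hP : P ≪ μ) (hQ : Q ≪ μ) :
    KLdiv P ((2 : ℝ≥0∞)⁻¹ • P + (2 : ℝ≥0∞)⁻¹ • Q) =
      ∫ x, (P.rnDeriv μ x).toReal * log ((P.rnDeriv μ x).toReal /
        (((P.rnDeriv μ x).toReal + (Q.rnDeriv μ x).toReal) / 2)) ∂μ := by
  rw [integral_toReal_rnDeriv_mul hP]
  exact integral_congr_ae (llr_half_smul_add_ae_eq hP hQ)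

lemma integrable_llr_half_smul_add (P Q : Measure Ω) [IsProbabilityMeasure P]
    [IsProbabilityMeasure Q] :
    Integrable (llr P ((2 : ℝ≥0∞)⁻¹ • P + (2 : ℝ≥0∞)⁻¹ • Q)) P := by
  have hP : P ≪ P + Q := Measure.AbsolutelyContinuous.rfl.add_right _
  have hQ : Q ≪ P + Q := Measure.AbsolutelyContinuous.rfl.add_right' _
  rw [integrable_congr (llr_half_smul_add_ae_eq hP hQ),
    ← integrable_toReal_rnDeriv_mul_iff hP]
  exact integrable_mul_log_rnDeriv P Q (P + Q)

lemma jsFun_eq_half_add {a b : ℝ} (ha : 0 ≤ a) (hb : 0 ≤ b) :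
    jsFun a b = (a * log (a / ((a + b) / 2)) + b * log (b / ((b + a) / 2))) / 2 := by
  rw [mul_log_div_half_add ha hb, mul_log_div_half_add hb ha, jsFun, add_comm b a]
  ring

lemma integrable_jsFun_rnDeriv (P Q μ : Measure Ω) [IsFiniteMeasure P] [IsFiniteMeasure Q] :
    Integrable (fun x ↦ jsFun (P.rnDeriv μ x).toReal (Q.rnDeriv μ x).toReal) μ := by
  simp_rw [jsFun_eq_half_add ENNReal.toReal_nonneg ENNReal.toReal_nonneg]
  exact ((integrable_mul_log_rnDeriv P Q μ).add (integrable_mul_log_rnDeriv Q P μ)).div_const 2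

lemma JSdiv_eq_integral_jsFun {P Q μ : Measure Ω} [IsProbabilityMeasure P]
    [IsProbabilityMeasure Q] [IsFiniteMeasure μ] (hP : P ≪ μ) (hQ : Q ≪ μ) :
    JSdiv P Q = ∫ x, jsFun (P.rnDeriv μ x).toReal (Q.rnDeriv μ x).toReal ∂μ := by
  simp_rw [jsFun_eq_half_add ENNReal.toReal_nonneg ENNReal.toReal_nonneg]
  rw [integral_div, integral_add (integrable_mul_log_rnDeriv P Q μ)
    (integrable_mul_log_rnDeriv Q P μ), ← KLdiv_half_smul_add hP hQ,
    ← KLdiv_half_smul_add hQ hP, half_smul_add_half_smul_comm Q P, JSdiv]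

/-- The square root of the Jensen–Shannon divergence satisfies the triangle inequality. -/
theorem sqrt_JSdiv_triangle (P Q R : Measure Ω) [IsProbabilityMeasure P] [IsProbabilityMeasure Q]
    [IsProbabilityMeasure R] :
    √(JSdiv P R) ≤ √(JSdiv P Q) + √(JSdiv Q R) := by
  set μ := P + Q + R
  have hP : P ≪ μ := (Measure.AbsolutelyContinuous.rfl.add_right _).add_right _
  have hQ : Q ≪ μ := (Measure.AbsolutelyContinuous.rfl.add_right' _).add_right _
  have hR : R ≪ μ := Measure.AbsolutelyContinuous.rfl.add_right' _
  let d : Measure Ω → Measure Ω → Ω → ℝ :=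
    fun A B x ↦ jsFun (A.rnDeriv μ x).toReal (B.rnDeriv μ x).toReal
  have hd_nonneg : ∀ A B x, 0 ≤ d A B x := fun A B x ↦
    jsFun_nonneg ENNReal.toReal_nonneg ENNReal.toReal_nonneg
  have hsq : ∀ A B x, √(d A B x) ^ 2 = d A B x := fun A B x ↦ sq_sqrt (hd_nonneg A B x)
  have hmem : ∀ (A B : Measure Ω) [IsProbabilityMeasure A] [IsProbabilityMeasure B],
      MemLp (fun x ↦ √(d A B x)) 2 μ := by
    intro A B _ _
    have hi := integrable_jsFun_rnDeriv A B μ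
    refine (memLp_two_iff_integrable_sq (continuous_sqrt.comp_aestronglyMeasurable hi.1)).2 ?_
    exact hi.congr (Filter.Eventually.of_forall fun x ↦ (hsq A B x).symm)
  have hPQ := hmem P Q
  have hQR := hmem Q R
  have hmink := sqrt_integral_add_sq_le hPQ hQR
  simp only [hsq] at hmink
  rw [JSdiv_eq_integral_jsFun hP hR, JSdiv_eq_integral_jsFun hP hQ, JSdiv_eq_integral_jsFun hQ hR]
  refine le_trans (sqrt_le_sqrt (integral_mono (integrable_jsFun_rnDeriv P R μ)
    (hPQ.add hQR).integrable_sq fun x ↦ ?_)) hmink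
  change d P R x ≤ (√(d P Q x) + √(d Q R x)) ^ 2
  rw [← hsq P R x]
  exact pow_le_pow_left₀ (sqrt_nonneg _)
    (sqrt_jsFun_triangle ENNReal.toReal_nonneg ENNReal.toReal_nonneg ENNReal.toReal_nonneg) 2

lemma KLdiv_eq_toReal_klDiv {P M : Measure Ω} [IsProbabilityMeasure P] [IsProbabilityMeasure M]
    (h : P ≪ M) : KLdiv P M = (InformationTheory.klDiv P M).toReal :=
  (InformationTheory.toReal_klDiv_of_measure_eq h (by simp)).symm

lemma JSdiv_nonneg (P Q : Measure Ω) [IsProbabilityMeasure P] [IsProbabilityMeasure Q] :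
    0 ≤ JSdiv P Q := by
  rw [JSdiv, KLdiv_eq_toReal_klDiv (absolutelyContinuous_half_smul_add P Q),
    half_smul_add_half_smul_comm P Q,
    KLdiv_eq_toReal_klDiv (absolutelyContinuous_half_smul_add Q P)]
  positivity

variable {Ω' : Type*} [MeasurableSpace Ω']

lemma bind_half_smul_add_half_smul (P Q : Measure Ω) (κ : Kernel Ω Ω') :
    ((2 : ℝ≥0∞)⁻¹ • P + (2 : ℝ≥0∞)⁻¹ • Q).bind κ =
      (2 : ℝ≥0∞)⁻¹ • P.bind κ + (2 : ℝ≥0∞)⁻¹ • Q.bind κ := by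
  rw [Measure.comp_add, Measure.comp_smul, Measure.comp_smul]

lemma KLdiv_half_smul_add_bind_le (P Q : Measure Ω) [IsProbabilityMeasure P]
    [IsProbabilityMeasure Q] (κ : Kernel Ω Ω') [IsMarkovKernel κ] :
    KLdiv (P.bind κ) ((2 : ℝ≥0∞)⁻¹ • P.bind κ + (2 : ℝ≥0∞)⁻¹ • Q.bind κ) ≤
      KLdiv P ((2 : ℝ≥0∞)⁻¹ • P + (2 : ℝ≥0∞)⁻¹ • Q) := by
  rw [KLdiv_eq_toReal_klDiv (absolutelyContinuous_half_smul_add _ _),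
    KLdiv_eq_toReal_klDiv (absolutelyContinuous_half_smul_add P Q),
    ← bind_half_smul_add_half_smul]
  exact ENNReal.toReal_mono
    (InformationTheory.klDiv_ne_top (absolutelyContinuous_half_smul_add P Q)
      (integrable_llr_half_smul_add P Q))
    (InformationTheory.klDiv_comp_right_le _ _ κ)

/-- The data-processing inequality for the Jensen–Shannon divergence. -/
theorem JSdiv_bind_le (P Q : Measure Ω) [IsProbabilityMeasure P] [IsProbabilityMeasure Q]
    (κ : Kernel Ω Ω') [IsMarkovKernel κ] :
    JSdiv (P.bind κ) (Q.bind κ) ≤ JSdiv P Q := by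
  have h1 := KLdiv_half_smul_add_bind_le P Q κ
  have h2 := KLdiv_half_smul_add_bind_le Q P κ
  rw [half_smul_add_half_smul_comm Q P, half_smul_add_half_smul_comm (Q.bind κ)] at h2
  unfold JSdiv
  linarith

end Measure

/-- a poor target pseudo-label prediction forces a large feature marginal
divergence. `μS, μT` are the (empirical) feature distributions, `κ` the shared stochastic
classifier, `μS.bind κ`, `μT.bind κ` the pseudo-label output distributions, and `νS, νT`
the ground-truth label marginals. -/
theorem poor_pseudo_label_lower_bound {Z Y : Type*} [MeasurableSpace Z] [Countable Z]
    [MeasurableSpace Y] [Fintype Y]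
    (μS μT : Measure Z) [IsProbabilityMeasure μS] [IsProbabilityMeasure μT]
    (κ : Kernel Z Y) [IsMarkovKernel κ]
    (νS νT : Measure Y) [IsProbabilityMeasure νS] [IsProbabilityMeasure νT]
    (P ε₁ ε₂ : ℝ)
    (hP : JSdiv νT (μT.bind fun z => κ z) = P)
    (hε₁ : JSdiv νS (μS.bind fun z => κ z) ≤ ε₁)
    (hε₂ : JSdiv νS νT ≤ ε₂) :
    JSdiv μS μT ≥ (max (Real.sqrt P - Real.sqrt ε₁ - Real.sqrt ε₂) 0) ^ 2 := by
  have h1 := sqrt_JSdiv_triangle νT νS (μT.bind κ)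
  have h2 := sqrt_JSdiv_triangle νS (μS.bind κ) (μT.bind κ)
  rw [JSdiv_comm νT νS] at h1
  have h3 := sqrt_le_sqrt (JSdiv_bind_le μS μT κ)
  have h4 := sqrt_le_sqrt hε₁
  have h5 := sqrt_le_sqrt hε₂
  subst hP
  rw [ge_iff_le, ← sq_sqrt (JSdiv_nonneg μS μT)]
  refine pow_le_pow_left₀ (le_max_right _ _) (max_le ?_ (sqrt_nonneg _)) 2
  linarith
end

section
/- Let S be the uniform distribution on {1,2,3} ⊂ ℝ and let T be the distribution on {1,2,3} with T({1}) = 1/4, T({2}) = 1/2, T({3}) = 1/4. Consider the threshold hypothesis class H = {h_t : t ∈ ℝ} with h_t(x) = 1 if x < t and h_t(x) = 0 otherwise, and define the domain-discrimination error err(h) = (1/2)·(S({x : h(x) = 0}) + T({x : h(x) = 1})). Then inf_{t∈ℝ} err(h_t) = 11/24, so the resulting H-divergence value is d_H(T,S) = 1 − 2·inf_{t} err(h_t) = 1/12, while the Jensen–Shannon divergence satisfies D_JS(T‖S) < 1/12. Hence the Jensen–Shannon divergence is not an upper bound for the H-divergence. -/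
open MeasureTheory Real
open scoped ENNReal

/-- The uniform source distribution on `{1, 2, 3} ⊆ ℝ`. -/
noncomputable def Scount : Measure ℝ :=
  (3 : ℝ≥0∞)⁻¹ • Measure.dirac 1 + (3 : ℝ≥0∞)⁻¹ • Measure.dirac 2 +
    (3 : ℝ≥0∞)⁻¹ • Measure.dirac 3

/-- The target distribution on `{1, 2, 3} ⊆ ℝ` with masses `1/4, 1/2, 1/4`. -/
noncomputable def Tcount : Measure ℝ :=
  (4 : ℝ≥0∞)⁻¹ • Measure.dirac 1 + (2 : ℝ≥0∞)⁻¹ • Measure.dirac 2 +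
    (4 : ℝ≥0∞)⁻¹ • Measure.dirac 3

/-- Domain-discrimination error of the threshold hypothesis `h_t(x) = 1{x < t}`:
`err(h_t) = (1/2)(S{h_t = 0} + T{h_t = 1})`. -/
noncomputable def discErr (t : ℝ) : ℝ :=
  (1 / 2) * ((Scount {x : ℝ | ¬ x < t}).toReal + (Tcount {x : ℝ | x < t}).toReal)

/-- The measure on `{1, 2, 3} ⊆ ℝ` with masses `a, b, a`. -/
noncomputable def symmThreePoint (a b : ℝ≥0∞) : Measure ℝ :=
  a • Measure.dirac 1 + b • Measure.dirac 2 + a • Measure.dirac 3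

lemma isFiniteMeasure_symmThreePoint {a b : ℝ≥0∞} (ha : a ≠ ∞) (hb : b ≠ ∞) :
    IsFiniteMeasure (symmThreePoint a b) := by
  constructor
  simp [symmThreePoint, ha.lt_top, hb.lt_top]

lemma symmThreePoint_eq_withDensity {a b c d : ℝ≥0∞} (hc : c ≠ 0) (hc' : c ≠ ∞)
    (hd : d ≠ 0) (hd' : d ≠ ∞) :
    symmThreePoint a b =
      (symmThreePoint c d).withDensity (fun x => if x = 2 then b / d else a / c) := by
  ext s hs
  rw [withDensity_apply _ hs, ← lintegral_indicator hs]
  have h1 : c * (a / c) = a := ENNReal.mul_div_cancel hc hc'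
  have h2 : d * (b / d) = b := ENNReal.mul_div_cancel hd hd'
  simp only [symmThreePoint, lintegral_add_measure, lintegral_smul_measure, lintegral_dirac,
    Measure.add_apply, Measure.smul_apply, Measure.dirac_apply, smul_eq_mul, Set.indicator]
  norm_num
  split_ifs <;> simp [h1, h2]

lemma integral_symmThreePoint {a b : ℝ≥0∞} (ha : a ≠ ∞) (hb : b ≠ ∞) (f : ℝ → ℝ) :
    ∫ x, f x ∂symmThreePoint a b =
      a.toReal * f 1 + b.toReal * f 2 + a.toReal * f 3 := by
  have hi (e : ℝ≥0∞) (he : e ≠ ∞) (x : ℝ) : Integrable f (e • Measure.dirac x) :=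
    (integrable_dirac (by simp)).smul_measure he
  rw [symmThreePoint, integral_add_measure ((hi a ha 1).add_measure (hi b hb 2)) (hi a ha 3),
    integral_add_measure (hi a ha 1) (hi b hb 2)]
  simp [integral_smul_measure]

lemma KLdiv_symmThreePoint {a b c d : ℝ≥0∞} (ha : a ≠ ∞) (hb : b ≠ ∞)
    (hc : c ≠ 0) (hc' : c ≠ ∞) (hd : d ≠ 0) (hd' : d ≠ ∞) :
    KLdiv (symmThreePoint a b) (symmThreePoint c d) =
      2 * (a.toReal * log (a.toReal / c.toReal)) + b.toReal * log (b.toReal / d.toReal) := by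
  have := isFiniteMeasure_symmThreePoint hc' hd'
  have hmeas : Measurable (fun x : ℝ => if x = 2 then b / d else a / c) :=
    Measurable.ite (measurableSet_singleton _) measurable_const measurable_const
  have heq := symmThreePoint_eq_withDensity (a := a) (b := b) hc hc' hd hd'
  have hac : symmThreePoint a b ≪ symmThreePoint c d :=
    heq ▸ withDensity_absolutelyContinuous _ _
  have hae : (symmThreePoint a b).rnDeriv (symmThreePoint c d) =ᵐ[symmThreePoint a b]
      fun x => if x = 2 then b / d else a / c := by
    refine hac.ae_le ?_
    have h := Measure.rnDeriv_withDensity (symmThreePoint c d) hmeas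
    rwa [← heq] at h
  rw [KLdiv, integral_congr_ae (hae.mono fun x hx => by rw [hx]),
    integral_symmThreePoint ha hb]
  norm_num [ENNReal.toReal_div]
  ring

lemma Scount_eq_symmThreePoint : Scount = symmThreePoint 3⁻¹ 3⁻¹ := rfl

lemma Tcount_eq_symmThreePoint : Tcount = symmThreePoint 4⁻¹ 2⁻¹ := rfl

lemma mixture_symmThreePoint (a b c d : ℝ≥0∞) :
    (2 : ℝ≥0∞)⁻¹ • symmThreePoint a b + (2 : ℝ≥0∞)⁻¹ • symmThreePoint c d =
      symmThreePoint (2⁻¹ * a + 2⁻¹ * c) (2⁻¹ * b + 2⁻¹ * d) := by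
  simp only [symmThreePoint, smul_add, add_smul, mul_smul]
  abel

lemma JSdiv_Tcount_Scount_lt : JSdiv Tcount Scount < 1 / 12 := by
  have hm : (2⁻¹ * 4⁻¹ + 2⁻¹ * 3⁻¹ : ℝ≥0∞).toReal = 7 / 24 := by
    rw [ENNReal.toReal_add (by finiteness) (by finiteness)]
    norm_num
  have hm' : (2⁻¹ * 2⁻¹ + 2⁻¹ * 3⁻¹ : ℝ≥0∞).toReal = 5 / 12 := by
    rw [ENNReal.toReal_add (by finiteness) (by finiteness)]
    norm_num
  rw [JSdiv, Scount_eq_symmThreePoint, Tcount_eq_symmThreePoint, mixture_symmThreePoint,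
    KLdiv_symmThreePoint (by simp) (by simp) (by simp) (by finiteness) (by simp) (by finiteness),
    KLdiv_symmThreePoint (by simp) (by simp) (by simp) (by finiteness) (by simp) (by finiteness),
    hm, hm']
  norm_num
  have h1 := log_le_sub_one_of_pos (show (0 : ℝ) < 6 / 7 by norm_num)
  have h2 := log_le_sub_one_of_pos (show (0 : ℝ) < 6 / 5 by norm_num)
  have h3 := log_le_sub_one_of_pos (show (0 : ℝ) < 8 / 7 by norm_num)
  have h4 := log_le_sub_one_of_pos (show (0 : ℝ) < 4 / 5 by norm_num)
  linarith

lemma measureReal_symmThreePoint {a b : ℝ≥0∞} (ha : a ≠ ∞) (hb : b ≠ ∞) {s : Set ℝ}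
    (hs : MeasurableSet s) :
    (symmThreePoint a b s).toReal =
      a.toReal * s.indicator 1 1 + b.toReal * s.indicator 1 2 + a.toReal * s.indicator 1 3 := by
  rw [← integral_symmThreePoint ha hb, integral_indicator_one hs, measureReal_def]

lemma discErr_eq (t : ℝ) :
    discErr t = (1 / 2) * ((3⁻¹ * (if 1 < t then 0 else 1) + 3⁻¹ * (if 2 < t then 0 else 1)
      + 3⁻¹ * (if 3 < t then 0 else 1)) + (4⁻¹ * (if 1 < t then 1 else 0)
      + 2⁻¹ * (if 2 < t then 1 else 0) + 4⁻¹ * (if 3 < t then 1 else 0))) := by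
  rw [discErr, Scount_eq_symmThreePoint, Tcount_eq_symmThreePoint,
    show {x : ℝ | ¬ x < t} = (Set.Iio t)ᶜ from rfl, show {x : ℝ | x < t} = Set.Iio t from rfl,
    measureReal_symmThreePoint (by simp) (by simp) measurableSet_Iio.compl,
    measureReal_symmThreePoint (by simp) (by simp) measurableSet_Iio]
  simp [Set.indicator_apply, ← not_lt, ite_not]

lemma iInf_discErr : (⨅ t : ℝ, discErr t) = 11 / 24 := by
  have hle (t : ℝ) : 11 / 24 ≤ discErr t := by
    rw [discErr_eq]
    split_ifs <;> linarith
  refine le_antisymm ?_ (le_ciInf hle)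
  refine (ciInf_le ⟨11 / 24, ?_⟩ 2).trans ?_
  · rintro _ ⟨t, rfl⟩
    exact hle t
  · rw [discErr_eq]
    norm_num

/-- for these two distributions the best threshold discrimination error is
`11/24`, hence the `H`-divergence value is `1 - 2 · inf err = 1/12`, while the
Jensen–Shannon divergence is strictly smaller than `1/12`: JS divergence is not an upper
bound for the `H`-divergence. -/
theorem jsDiv_not_upper_bound_of_H_divergence :
    (⨅ t : ℝ, discErr t) = 11 / 24 ∧
      1 - 2 * (⨅ t : ℝ, discErr t) = 1 / 12 ∧
      JSdiv Tcount Scount < 1 / 12 := by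
  refine ⟨iInf_discErr, ?_, JSdiv_Tcount_Scount_lt⟩
  rw [iInf_discErr]
  norm_num
end
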